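/- arXiv:0802.3820 — 5 statements merged into one kernel-verified Lean document; each statement's English description precedes it below -/
import Mathlib

section
/- Let K be a finite simple graph with at least three vertices and at least one edge. Suppose that for every edge xy of K, the graph K − x − y contains no θ-subgraph and every vertex of K − x − y has at least two neighbors in K − x − y. Then K is isomorphic to the complete graph K_5 or to the complete bipartite graph K_{3,3}. -/
open SimpleGraph

/-- The vertex set of the induced subgraph `K − x − y`. -/
def delTwo {V : Type*} (x y : V) : Set V := {v | v ≠ x ∧ v ≠ y}

/-- `G` has a θ-subgraph with all vertices inside the set `s`: two distinct vertices
`u, v ∈ s` joined by three distinct paths lying in `s` which pairwise have no common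
vertices other than `u` and `v`. -/
def HasThetaIn {V : Type*} (G : SimpleGraph V) (s : Set V) : Prop :=
  ∃ (u v : V) (p q r : G.Walk u v),
    u ∈ s ∧ v ∈ s ∧ u ≠ v ∧
    p.IsPath ∧ q.IsPath ∧ r.IsPath ∧
    p ≠ q ∧ p ≠ r ∧ q ≠ r ∧
    (∀ w ∈ p.support, w ∈ s) ∧ (∀ w ∈ q.support, w ∈ s) ∧ (∀ w ∈ r.support, w ∈ s) ∧
    (∀ w, w ∈ p.support → w ∈ q.support → w = u ∨ w = v) ∧
    (∀ w, w ∈ p.support → w ∈ r.support → w = u ∨ w = v) ∧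
    (∀ w, w ∈ q.support → w ∈ r.support → w = u ∨ w = v)

/-- `G` has a θ-subgraph. -/
def HasTheta {V : Type*} (G : SimpleGraph V) : Prop := HasThetaIn G Set.univ

/-- The subgraph of `G` induced on the vertex set `s` is a cycle on `n ≥ 3` vertices:
it has `n ≥ 3` vertices, is connected, and each of its vertices has exactly two
neighbors in it. -/
def IsCycleSetOn {V : Type*} (G : SimpleGraph V) (s : Set V) (n : ℕ) : Prop :=
  3 ≤ n ∧ s.ncard = n ∧ (G.induce s).Connected ∧
  ∀ v ∈ s, ({w ∈ s | G.Adj v w}).ncard = 2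

namespace KuratowskiLemma

variable {V : Type*} {G : SimpleGraph V} {s : Set V}

/-- A cycle through `a` and `b` together with a further path from `a` to `b` forms a θ-subgraph. -/
lemma hasThetaIn_of_isCycle_of_start {a b : V} {c : G.Walk a a} (hc : c.IsCycle)
    (hcs : ∀ w ∈ c.support, w ∈ s) (hb : b ∈ c.support) (hab : a ≠ b)
    {q : G.Walk a b} (hq : q.IsPath) (hqs : ∀ w ∈ q.support, w ∈ s)
    (hqc : ∀ w ∈ q.support, w ∈ c.support → w = a ∨ w = b)
    {e : Sym2 V} (he : e ∈ q.edges) (hec : e ∉ c.edges) : HasThetaIn G s := by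
  classical
  have hspec := c.take_spec hb
  have hsup : ∀ w, w ∈ c.support ↔ w ∈ (c.takeUntil b hb).support ∨
      w ∈ (c.dropUntil b hb).support := fun w => by
    rw [← Walk.mem_support_append_iff, hspec]
  have hedges : c.edges = (c.takeUntil b hb).edges ++ (c.dropUntil b hb).edges := by
    rw [← Walk.edges_append, hspec]
  have hnd := hc.isTrail.edges_nodup
  rw [hedges, List.nodup_append'] at hnd
  have htail := hc.support_nodup
  rw [← hspec, Walk.tail_support_append, List.nodup_append'] at htail
  have hp1 : (c.takeUntil b hb).IsPath := hc.isPath_takeUntil hb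
  have hp2 : (c.dropUntil b hb).IsPath := by
    rw [← hspec] at hc
    exact hc.isPath_of_append_right (Walk.not_nil_of_ne hab)
  have hne : c.takeUntil b hb ≠ (c.dropUntil b hb).reverse := by
    intro h
    cases hl : (c.takeUntil b hb).edges with
    | nil =>
      have : (c.takeUntil b hb).length = 0 := by rw [← Walk.length_edges, hl]; rfl
      exact hab (Walk.eq_of_length_eq_zero this)
    | cons f l =>
      have h1 : f ∈ (c.takeUntil b hb).edges := by simp [hl]
      have h2 : f ∈ (c.dropUntil b hb).edges := by
        rw [h] at h1; simpa using h1
      exact hnd.2.2 h1 h2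
  refine ⟨a, b, c.takeUntil b hb, (c.dropUntil b hb).reverse, q, hcs _ (by simp), hcs _ hb, hab,
    hp1, hp2.reverse, hq, hne, ?_, ?_, ?_, ?_, hqs, ?_, ?_, ?_⟩
  · rintro rfl
    exact hec (by rw [hedges]; simp [he])
  · rintro rfl
    exact hec (by rw [hedges]; simpa using Or.inr he)
  · exact fun w hw => hcs w ((hsup w).2 (Or.inl hw))
  · exact fun w hw => hcs w ((hsup w).2 (Or.inr (by simpa using hw)))
  · intro w h1 h2
    rw [Walk.support_reverse, List.mem_reverse] at h2
    by_contra! hw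
    rw [Walk.mem_support_iff] at h1 h2
    exact htail.2.2 (h1.resolve_left hw.1) (h2.resolve_left hw.2)
  · exact fun w h1 h2 => hqc w h2 ((hsup w).2 (Or.inl h1))
  · exact fun w h1 h2 => hqc w h2 ((hsup w).2 (Or.inr (by simpa using h1)))

lemma hasThetaIn_of_isCycle {u a b : V} {c : G.Walk u u} (hc : c.IsCycle)
    (hcs : ∀ w ∈ c.support, w ∈ s) (ha : a ∈ c.support) (hb : b ∈ c.support) (hab : a ≠ b)
    {q : G.Walk a b} (hq : q.IsPath) (hqs : ∀ w ∈ q.support, w ∈ s)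
    (hqc : ∀ w ∈ q.support, w ∈ c.support → w = a ∨ w = b)
    {e : Sym2 V} (he : e ∈ q.edges) (hec : e ∉ c.edges) : HasThetaIn G s := by
  classical
  have hsup : ∀ w, w ∈ (c.rotate a ha).support ↔ w ∈ c.support := fun w => by
    rw [Walk.rotate, Walk.mem_support_append_iff, or_comm, ← Walk.mem_support_append_iff,
      Walk.take_spec]
  refine hasThetaIn_of_isCycle_of_start (hc.rotate ha) (fun w hw => hcs w ((hsup w).1 hw))
    ((hsup b).2 hb) hab hq hqs (fun w h1 h2 => hqc w h1 ((hsup w).1 h2)) he ?_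
  rwa [(c.rotate_edges a ha).perm.mem_iff]

/-- In a θ-free vertex set, a vertex of a cycle has at most two neighbors on that cycle. -/
lemma ncard_adj_support_le_two [Finite V] (hθ : ¬ HasThetaIn G s) {u w : V} {c : G.Walk u u}
    (hc : c.IsCycle) (hcs : ∀ z ∈ c.support, z ∈ s) (hw : w ∈ c.support) :
    {z | z ∈ c.support ∧ G.Adj w z}.ncard ≤ 2 := by
  rw [← hc.ncard_neighborSet_toSubgraph_eq_two hw]
  refine Set.ncard_le_ncard ?_ (Set.toFinite _)
  rintro z ⟨hz, hwz⟩
  rw [Subgraph.mem_neighborSet, Walk.adj_toSubgraph_iff_mem_edges]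
  by_contra he
  exact hθ (hasThetaIn_of_isCycle hc hcs hw hz hwz.ne (q := hwz.toWalk) hwz.isPath_toWalk
    (by simp [hcs _ hw, hcs _ hz]) (by simp) (by simp) he)

lemma exists_append_of_last {u v : V} (p : G.Walk u v) (P : V → Prop)
    (h : ∃ c ∈ p.support, P c) :
    ∃ (c : V) (q : G.Walk u c) (r : G.Walk c v), p = q.append r ∧ P c ∧
      ∀ d ∈ p.support, P d → d ∈ q.support := by
  induction p with
  | nil =>
    obtain ⟨c, hc, hP⟩ := h
    rw [Walk.support_nil, List.mem_singleton] at hc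
    subst hc
    exact ⟨c, .nil, .nil, rfl, hP, fun d hd _ => hd⟩
  | cons hadj p ih =>
    by_cases htail : ∃ c ∈ p.support, P c
    · obtain ⟨c, q, r, rfl, hP, hq⟩ := ih htail
      refine ⟨c, .cons hadj q, r, rfl, hP, fun d hd hPd => ?_⟩
      rw [Walk.support_cons, List.mem_cons] at hd ⊢
      exact hd.imp_right fun hd => hq d hd hPd
    · obtain ⟨c, hc, hP⟩ := h
      rw [Walk.support_cons, List.mem_cons] at hc
      rcases hc with rfl | hc
      · refine ⟨c, .nil, .cons hadj p, rfl, hP, fun d hd hPd => ?_⟩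
        rw [Walk.support_cons, List.mem_cons] at hd
        rcases hd with rfl | hd
        · simp
        · exact absurd ⟨d, hd, hPd⟩ htail
      · exact absurd ⟨c, hc, hP⟩ htail

/-- `p` is a path inside `s` of maximal length. -/
def IsLongestPathIn (s : Set V) {u v : V} (p : G.Walk u v) : Prop :=
  p.IsPath ∧ (∀ w ∈ p.support, w ∈ s) ∧
    ∀ (u' v' : V) (q : G.Walk u' v'), q.IsPath → (∀ w ∈ q.support, w ∈ s) → q.length ≤ p.length

lemma exists_isLongestPathIn [Fintype V] (hs : s.Nonempty) :
    ∃ (u v : V) (p : G.Walk u v), IsLongestPathIn s p := by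
  classical
  obtain ⟨a, ha⟩ := hs
  let Q : ℕ → Prop := fun n => ∃ (u v : V) (p : G.Walk u v), p.IsPath ∧
    (∀ w ∈ p.support, w ∈ s) ∧ p.length = n
  have h0 : Q 0 := ⟨a, a, .nil, .nil, by simpa using ha, rfl⟩
  obtain ⟨u, v, p, hp, hps, hl⟩ := Nat.findGreatest_spec (Nat.zero_le (Fintype.card V)) h0
  refine ⟨u, v, p, hp, hps, fun u' v' q hq hqs => ?_⟩
  rw [hl]
  exact Nat.le_findGreatest hq.length_lt.le ⟨u', v', q, hq, hqs, rfl⟩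

lemma IsLongestPathIn.mem_support {u v d : V} {p : G.Walk u v} (hp : IsLongestPathIn s p)
    (hd : d ∈ s) (h : G.Adj u d) : d ∈ p.support := by
  by_contra hdp
  have := hp.2.2 _ _ (.cons h.symm p) (hp.1.cons hdp) (by
    intro w hw
    rw [Walk.support_cons, List.mem_cons] at hw
    rcases hw with rfl | hw
    exacts [hd, hp.2.1 w hw])
  simp at this

lemma exists_pair_of_two_le_ncard {t : Set V} (h : 2 ≤ t.ncard) :
    ∃ a ∈ t, ∃ b ∈ t, a ≠ b := by
  have hfin : t.Finite := Set.finite_of_ncard_pos (by omega)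
  exact (Set.one_lt_ncard hfin).1 h

/-- A longest path starts along a cycle containing all neighbors of its first vertex. -/
lemma IsLongestPathIn.exists_isCycle {u v : V} {p : G.Walk u v} (hp : IsLongestPathIn s p)
    (hdeg : 2 ≤ {w ∈ s | G.Adj u w}.ncard) :
    ∃ (c : V) (q : G.Walk u c) (r : G.Walk c v) (h : G.Adj c u), p = q.append r ∧
      (Walk.cons h q).IsCycle ∧ ∀ d ∈ s, G.Adj u d → d ∈ q.support := by
  obtain ⟨a, ⟨has, ha⟩, b, ⟨hbs, hb⟩, hab⟩ := exists_pair_of_two_le_ncard hdeg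
  obtain ⟨c, q, r, rfl, hc, hq⟩ := exists_append_of_last p (G.Adj u)
    ⟨a, hp.mem_support has ha, ha⟩
  have haq := hq a (hp.mem_support has ha) ha
  have hbq := hq b (hp.mem_support hbs hb) hb
  have hqp : q.IsPath := hp.1.of_append_left
  refine ⟨c, q, r, hc.symm, rfl, ?_, fun d hds hd => hq d (hp.mem_support hds hd) hd⟩
  rw [Walk.cons_isCycle_iff]
  refine ⟨hqp, fun he => ?_⟩
  rw [Sym2.eq_swap] at he
  rw [hqp.eq_adj_toWalk_of_mem_edges he] at haq hbq
  simp [ha.ne', hb.ne'] at haq hbq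
  exact hab (haq.trans hbq.symm)

lemma IsLongestPathIn.ncard_adj_le_two [Finite V] (hθ : ¬ HasThetaIn G s) {u v : V}
    {p : G.Walk u v} (hp : IsLongestPathIn s p) (hdeg : 2 ≤ {w ∈ s | G.Adj u w}.ncard) :
    {w ∈ s | G.Adj u w}.ncard ≤ 2 := by
  obtain ⟨c, q, r, h, rfl, hcyc, hq⟩ := hp.exists_isCycle hdeg
  have hcs : ∀ z ∈ (Walk.cons h q).support, z ∈ s := by
    intro z hz
    rw [Walk.support_cons, List.mem_cons] at hz
    refine hp.2.1 z ((Walk.mem_support_append_iff _ _).2 (Or.inl ?_))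
    rcases hz with rfl | hz
    exacts [q.end_mem_support, hz]
  refine le_trans (Set.ncard_le_ncard ?_ (Set.toFinite _))
    (ncard_adj_support_le_two hθ hcyc hcs (w := u) (by simp))
  rintro z ⟨hzs, hz⟩
  exact ⟨by simp [hq z hzs hz], hz⟩

/-- Reversing the initial cycle segment of a longest path gives a longest path. -/
lemma IsLongestPathIn.reverse_initial {u v t c : V} {d : G.Walk u t} {h : G.Adj t c}
    {r : G.Walk c v} (hp : IsLongestPathIn s ((d.concat h).append r)) (huc : G.Adj u c) :
    IsLongestPathIn s (d.reverse.append (.cons huc r)) := by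
  have hperm : (d.reverse.append (.cons huc r)).support.Perm
      ((d.concat h).append r).support := by
    rw [Walk.concat_append, Walk.support_append, Walk.support_append]
    simpa using (List.reverse_perm d.support).append_right r.support
  refine ⟨?_, fun w hw => hp.2.1 w (hperm.mem_iff.1 hw), fun u' v' q hq hqs => ?_⟩
  · rw [Walk.isPath_def, hperm.nodup_iff, ← Walk.isPath_def]
    exact hp.1
  · refine (hp.2.2 u' v' q hq hqs).trans (le_of_eq ?_)
    simp
    omega

/-- A path of length at least two between `u` and `t` through the edge `xy`. -/
lemma exists_path_through_edge {x y u t : V} (hxy : G.Adj x y) (hut : u ≠ t)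
    (hux : u ≠ x) (huy : u ≠ y) (htx : t ≠ x) (hty : t ≠ y)
    (hu : G.Adj u x ∨ G.Adj u y) (ht : G.Adj t x ∨ G.Adj t y) :
    ∃ q : G.Walk u t, q.IsPath ∧
      (∀ w ∈ q.support, w = u ∨ w = t ∨ w = x ∨ w = y) ∧
      (s(u, x) ∈ q.edges ∨ s(u, y) ∈ q.edges) := by
  have hne := hxy.ne
  rcases hu with hu | hu <;> rcases ht with ht | ht
  · refine ⟨.cons hu (.cons ht.symm .nil), ?_, ?_, ?_⟩ <;> (simp [*]; try grind)
  · refine ⟨.cons hu (.cons hxy (.cons ht.symm .nil)), ?_, ?_, ?_⟩ <;> (simp [*]; try grind)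
  · refine ⟨.cons hu (.cons hxy.symm (.cons ht.symm .nil)), ?_, ?_, ?_⟩ <;> (simp [*]; try grind)
  · refine ⟨.cons hu (.cons ht.symm .nil), ?_, ?_, ?_⟩ <;> (simp [*]; try grind)

/-- Every vertex is avoided by some edge. -/
lemma exists_adj_avoiding {K : SimpleGraph V} [Fintype V] (hcard : 3 ≤ Fintype.card V)
    (hedge : ∃ x y, K.Adj x y)
    (hdeg : ∀ x y, K.Adj x y → ∀ v ∈ delTwo x y, 2 ≤ {w ∈ delTwo x y | K.Adj v w}.ncard)
    (v : V) : ∃ a b, K.Adj a b ∧ v ∈ delTwo a b := by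
  classical
  obtain ⟨x, y, hxy⟩ := hedge
  by_cases hv : v ∈ delTwo x y
  · exact ⟨x, y, hxy, hv⟩
  · obtain ⟨w, hw⟩ : ∃ w, w ∉ ({x, y} : Finset V) := by
      by_contra! hall
      have := Finset.card_le_card (fun w _ => hall w : Finset.univ ⊆ ({x, y} : Finset V))
      have := Finset.card_le_two (a := x) (b := y)
      simp only [Finset.card_univ] at *
      omega
    have hw' : w ∈ delTwo x y := by simpa [delTwo] using hw
    obtain ⟨z, ⟨hz, hwz⟩, -⟩ := exists_pair_of_two_le_ncard (hdeg x y hxy w hw')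
    refine ⟨w, z, hwz, ?_⟩
    simp only [delTwo, Set.mem_ofPred_eq] at hv hw' hz ⊢
    grind

lemma exists_adj_ne {K : SimpleGraph V} [Fintype V] (hcard : 3 ≤ Fintype.card V)
    (hedge : ∃ x y, K.Adj x y)
    (hdeg : ∀ x y, K.Adj x y → ∀ v ∈ delTwo x y, 2 ≤ {w ∈ delTwo x y | K.Adj v w}.ncard)
    (v u : V) : ∃ w, K.Adj v w ∧ w ≠ u := by
  obtain ⟨a, b, hab, hv⟩ := exists_adj_avoiding hcard hedge hdeg v
  obtain ⟨c, ⟨-, hc⟩, d, ⟨-, hd⟩, hcd⟩ := exists_pair_of_two_le_ncard (hdeg a b hab v hv)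
  by_cases h : c = u
  · exact ⟨d, hd, fun h' => hcd (h.trans h'.symm)⟩
  · exact ⟨c, hc, h⟩

lemma three_le_ncard_neighborSet {K : SimpleGraph V} [Fintype V] (hcard : 3 ≤ Fintype.card V)
    (hedge : ∃ x y, K.Adj x y)
    (hdeg : ∀ x y, K.Adj x y → ∀ v ∈ delTwo x y, 2 ≤ {w ∈ delTwo x y | K.Adj v w}.ncard)
    (v : V) : 3 ≤ (K.neighborSet v).ncard := by
  obtain ⟨a, hva, -⟩ := exists_adj_ne hcard hedge hdeg v v
  obtain ⟨b, hab, hbv⟩ := exists_adj_ne hcard hedge hdeg a v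
  have h2 := hdeg a b hab v ⟨hva.ne, hbv.symm⟩
  have h3 := Set.ncard_insert_of_notMem (a := a) (s := {w ∈ delTwo a b | K.Adj v w})
    (by simp [delTwo]) (Set.toFinite _)
  have h4 : insert a {w ∈ delTwo a b | K.Adj v w} ⊆ K.neighborSet v := by
    rintro w (rfl | hw)
    exacts [hva, hw.2]
  have := Set.ncard_le_ncard h4 (Set.toFinite _)
  omega

lemma adj_or_adj_of_ncard_le_two {K : SimpleGraph V} [Finite V] {x y v : V}
    (h3 : 3 ≤ (K.neighborSet v).ncard) (h2 : {w ∈ delTwo x y | K.Adj v w}.ncard ≤ 2) :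
    K.Adj v x ∨ K.Adj v y := by
  by_contra! h
  have : K.neighborSet v ⊆ {w ∈ delTwo x y | K.Adj v w} := by
    intro w hw
    rw [mem_neighborSet] at hw
    exact ⟨⟨by rintro rfl; exact h.1 hw, by rintro rfl; exact h.2 hw⟩, hw⟩
  have := Set.ncard_le_ncard this (Set.toFinite _)
  omega

/-- Under the hypotheses of the Kuratowski lemma every `K − x − y` is `2`-regular. -/
lemma ncard_adj_delTwo_eq_two {K : SimpleGraph V} [Fintype V]
    (h3 : ∀ v, 3 ≤ (K.neighborSet v).ncard)
    (hθ : ∀ x y, K.Adj x y → ¬ HasThetaIn K (delTwo x y))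
    (hdeg : ∀ x y, K.Adj x y → ∀ v ∈ delTwo x y, 2 ≤ {w ∈ delTwo x y | K.Adj v w}.ncard)
    {x y v : V} (hxy : K.Adj x y) (hv : v ∈ delTwo x y) :
    {w ∈ delTwo x y | K.Adj v w}.ncard = 2 := by
  have hθxy := hθ x y hxy
  obtain ⟨u, e, p, hp⟩ := exists_isLongestPathIn (G := K) ⟨v, hv⟩
  have hus : u ∈ delTwo x y := hp.2.1 _ p.start_mem_support
  obtain ⟨c, q, r, hcu, rfl, hcyc, -⟩ := hp.exists_isCycle (hdeg x y hxy u hus)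
  have hqs : ∀ z ∈ q.support, z ∈ delTwo x y := fun z hz =>
    hp.2.1 z ((Walk.mem_support_append_iff _ _).2 (Or.inl hz))
  have hmem : ∀ z, z ∈ (Walk.cons hcu q).support ↔ z ∈ q.support := by
    intro z
    rw [Walk.support_cons, List.mem_cons, or_iff_right_of_imp]
    rintro rfl
    exact q.end_mem_support
  -- the last vertex `t` of the cycle before `c` also starts a longest path
  obtain ⟨t, htq, hut, htdeg⟩ : ∃ t ∈ q.support, u ≠ t ∧
      {w ∈ delTwo x y | K.Adj t w}.ncard ≤ 2 := by
    obtain ⟨z, hz, q', rfl⟩ := Walk.exists_eq_cons_of_ne hcu.ne' q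
    obtain ⟨t, d, h, hd⟩ := Walk.exists_cons_eq_concat hz q'
    rw [hd] at hp hcyc hqs ⊢
    have htd : t ∈ (d.concat h).support := by simp [Walk.support_concat]
    refine ⟨t, htd, ?_, (hp.reverse_initial hcu.symm).ncard_adj_le_two hθxy
      (hdeg x y hxy t (hqs t htd))⟩
    rintro rfl
    have := ((Walk.cons_isCycle_iff _ _).1 hcyc).2
    exact this (by simp [Walk.edges_concat, Sym2.eq_swap])
  have huadj := adj_or_adj_of_ncard_le_two (h3 u)
    (hp.ncard_adj_le_two hθxy (hdeg x y hxy u hus))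
  have htadj := adj_or_adj_of_ncard_le_two (h3 t) htdeg
  have hts := hqs t htq
  have hnoedge : ∀ a b, a ∈ delTwo x y → b ∈ delTwo x y → K.Adj a b → a ∉ q.support →
      b ∈ q.support := by
    intro a b has hbs hab haq
    by_contra hbq
    obtain ⟨Q, hQ, hQs, hQe⟩ := exists_path_through_edge hxy hut hus.1 hus.2 hts.1 hts.2
      huadj htadj
    have hqab : ∀ z ∈ q.support, z ∈ delTwo a b := fun z hz =>
      ⟨by rintro rfl; exact haq hz, by rintro rfl; exact hbq hz⟩
    obtain ⟨f, hf, hfc⟩ : ∃ f ∈ Q.edges, f ∉ (Walk.cons hcu q).edges := by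
      rcases hQe with h | h
      · refine ⟨_, h, fun h' => ?_⟩
        exact (hqs _ ((hmem _).1 (Walk.snd_mem_support_of_mem_edges _ h'))).1 rfl
      · refine ⟨_, h, fun h' => ?_⟩
        exact (hqs _ ((hmem _).1 (Walk.snd_mem_support_of_mem_edges _ h'))).2 rfl
    refine hθ a b hab (hasThetaIn_of_isCycle hcyc (fun z hz => hqab z ((hmem z).1 hz))
      ((hmem u).2 q.start_mem_support) ((hmem t).2 htq) hut hQ ?_ ?_ hf hfc)
    · intro w hw
      rcases hQs w hw with rfl | rfl | rfl | rfl
      · exact hqab _ q.start_mem_support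
      · exact hqab _ htq
      · exact ⟨has.1.symm, hbs.1.symm⟩
      · exact ⟨has.2.symm, hbs.2.symm⟩
    · intro w hw hwc
      have hwq := hqs w ((hmem w).1 hwc)
      rcases hQs w hw with h | h | h | h
      · exact Or.inl h
      · exact Or.inr h
      · exact absurd h hwq.1
      · exact absurd h hwq.2
  have hall : ∀ w ∈ delTwo x y, w ∈ q.support := by
    intro w hw
    by_contra hwq
    obtain ⟨a, ⟨has, ha⟩, b, ⟨hbs, hb⟩, hab⟩ := exists_pair_of_two_le_ncard (hdeg x y hxy w hw)
    have haq := hnoedge w a hw has ha hwq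
    have hbq := hnoedge w b hw hbs hb hwq
    refine hθxy (hasThetaIn_of_isCycle hcyc (fun z hz => hqs z ((hmem z).1 hz))
      ((hmem a).2 haq) ((hmem b).2 hbq) hab (q := .cons ha.symm (.cons hb .nil))
      ?_ ?_ ?_ (e := s(a, w)) (by simp) ?_)
    · simp [Walk.cons_isPath_iff, hab, ha.ne', hb.ne]
    · simp [has, hbs, hw]
    · intro z hz hzc
      have : z ≠ w := by rintro rfl; exact hwq ((hmem z).1 hzc)
      simpa [this] using hz
    · exact fun h' => hwq ((hmem _).1 (Walk.snd_mem_support_of_mem_edges _ h'))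
  refine le_antisymm ?_ (hdeg x y hxy v hv)
  refine le_trans (Set.ncard_le_ncard ?_ (Set.toFinite _))
    (ncard_adj_support_le_two hθxy hcyc (fun z hz => hqs z ((hmem z).1 hz))
      ((hmem v).2 (hall v hv)))
  rintro z ⟨hzs, hz⟩
  exact ⟨(hmem z).2 (hall z hzs), hz⟩

lemma ncard_neighborSet_eq {K : SimpleGraph V} [Finite V] {x y v : V}
    (h2 : {w ∈ delTwo x y | K.Adj v w}.ncard = 2) :
    (K.neighborSet v).ncard = 2 + {w ∈ ({x, y} : Set V) | K.Adj v w}.ncard := by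
  rw [← h2, ← Set.ncard_union_eq ?_ (Set.toFinite _) (Set.toFinite _)]
  · congr 1
    ext w
    simp only [delTwo, mem_neighborSet, Set.mem_union, Set.mem_ofPred_eq, Set.mem_insert_iff,
      Set.mem_singleton_iff]
    tauto
  · rw [Set.disjoint_left]
    simp only [delTwo, Set.mem_ofPred_eq, Set.mem_insert_iff, Set.mem_singleton_iff]
    tauto

lemma ncard_neighborSet_eq_four_iff {K : SimpleGraph V} [Finite V] {x y v : V} (hxy : x ≠ y)
    (h2 : {w ∈ delTwo x y | K.Adj v w}.ncard = 2) :
    (K.neighborSet v).ncard = 4 ↔ K.Adj v x ∧ K.Adj v y := by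
  have hpair : ({x, y} : Set V).ncard = 2 := Set.ncard_pair hxy
  have hsub : {w ∈ ({x, y} : Set V) | K.Adj v w} ⊆ {x, y} := Set.sep_subset _ _
  rw [ncard_neighborSet_eq h2]
  constructor
  · intro h
    have heq := Set.eq_of_subset_of_ncard_le hsub (by omega) (Set.toFinite _)
    have hx : x ∈ {w ∈ ({x, y} : Set V) | K.Adj v w} := by rw [heq]; simp
    have hy : y ∈ {w ∈ ({x, y} : Set V) | K.Adj v w} := by rw [heq]; simp
    exact ⟨hx.2, hy.2⟩
  · rintro ⟨hx, hy⟩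
    have : {w ∈ ({x, y} : Set V) | K.Adj v w} = {x, y} := by
      refine hsub.antisymm ?_
      rintro w (rfl | rfl)
      exacts [⟨by simp, hx⟩, ⟨by simp, hy⟩]
    rw [this, hpair]

lemma ncard_neighborSet_le_four {K : SimpleGraph V} [Finite V] {x y v : V} (hxy : x ≠ y)
    (h2 : {w ∈ delTwo x y | K.Adj v w}.ncard = 2) : (K.neighborSet v).ncard ≤ 4 := by
  have hpair : ({x, y} : Set V).ncard = 2 := Set.ncard_pair hxy
  have := Set.ncard_le_ncard (Set.sep_subset ({x, y} : Set V) (K.Adj v)) (Set.toFinite _)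
  have := ncard_neighborSet_eq h2
  omega

/-- A graph with all edges between a set of three vertices and its three-vertex complement, and no
others, is `K₃,₃`. -/
lemma nonempty_iso_completeBipartiteGraph {K : SimpleGraph V} [Finite V] {N : Set V}
    (hN : N.ncard = 3) (hNc : Nᶜ.ncard = 3) (hadj : ∀ a b, K.Adj a b ↔ (a ∈ N ↔ b ∉ N)) :
    Nonempty (K ≃g completeBipartiteGraph (Fin 3) (Fin 3)) := by
  classical
  let e₁ : N ≃ Fin 3 := Finite.equivFinOfCardEq hN
  let e₂ : (Nᶜ : Set V) ≃ Fin 3 := Finite.equivFinOfCardEq hNc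
  refine ⟨RelIso.symm ⟨(Equiv.sumCongr e₁ e₂).symm.trans (Equiv.Set.sumCompl N), ?_⟩⟩
  intro a b
  have h1 : ∀ i, (e₁.symm i : V) ∈ N := fun i => (e₁.symm i).2
  have h2 : ∀ i, (e₂.symm i : V) ∉ N := fun i => (e₂.symm i).2
  rcases a with a | a <;> rcases b with b | b <;> simp [hadj, h1, h2]

end KuratowskiLemma

/-- **Lemma on the Kuratowski graphs, (1) ⇒ (3).** If `K` is a finite simple graph with
at least three vertices and at least one edge such that for every edge `xy` the graph
`K − x − y` contains no θ-subgraph and every vertex of `K − x − y` has at least two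
neighbors in `K − x − y`, then `K` is isomorphic to `K₅` or to `K₃,₃`. -/
theorem stmt_0 {V : Type*} [Fintype V] (K : SimpleGraph V)
    (hcard : 3 ≤ Fintype.card V)
    (hedge : ∃ x y, K.Adj x y)
    (h : ∀ x y, K.Adj x y →
      ¬ HasThetaIn K (delTwo x y) ∧
      ∀ v ∈ delTwo x y, 2 ≤ ({w ∈ delTwo x y | K.Adj v w}).ncard) :
    Nonempty (K ≃g (⊤ : SimpleGraph (Fin 5))) ∨
    Nonempty (K ≃g completeBipartiteGraph (Fin 3) (Fin 3)) := by
  classical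
  have hθ : ∀ x y, K.Adj x y → ¬ HasThetaIn K (delTwo x y) := fun x y hxy => (h x y hxy).1
  have hdeg : ∀ x y, K.Adj x y → ∀ v ∈ delTwo x y, 2 ≤ {w ∈ delTwo x y | K.Adj v w}.ncard :=
    fun x y hxy => (h x y hxy).2
  have hother := KuratowskiLemma.exists_adj_ne hcard hedge hdeg
  have h3 := KuratowskiLemma.three_le_ncard_neighborSet hcard hedge hdeg
  have h2 : ∀ {x y v : V}, K.Adj x y → v ∈ delTwo x y →
      {w ∈ delTwo x y | K.Adj v w}.ncard = 2 := KuratowskiLemma.ncard_adj_delTwo_eq_two h3 hθ hdeg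
  have hdom : ∀ v, (K.neighborSet v).ncard = 4 → ∀ z, z ≠ v → K.Adj v z := by
    intro v hv z hz
    obtain ⟨z', hzz', hz'⟩ := hother z v
    exact ((KuratowskiLemma.ncard_neighborSet_eq_four_iff hzz'.ne
      (h2 hzz' ⟨hz.symm, hz'.symm⟩)).1 hv).1
  by_cases h4 : ∃ v, (K.neighborSet v).ncard = 4
  · left
    obtain ⟨v, hv⟩ := h4
    have hall : ∀ z, (K.neighborSet z).ncard = 4 := by
      intro z
      by_cases hz : z = v
      · rwa [hz]
      obtain ⟨z', hzz', hz'⟩ := hother z v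
      have hvz' := hdom v hv z' hz'
      exact (KuratowskiLemma.ncard_neighborSet_eq_four_iff hvz'.ne (h2 hvz' ⟨hz, hzz'.ne⟩)).2
        ⟨(hdom v hv z hz).symm, hzz'⟩
    have htop : K = ⊤ := by
      ext a b
      rw [top_adj]
      exact ⟨fun hab => hab.ne, fun hab => hdom a (hall a) b hab.symm⟩
    have hcard5 : Fintype.card V = 5 := by
      have hins : insert v (K.neighborSet v) = Set.univ := by
        ext z
        simpa [or_iff_not_imp_left] using hdom v hv z
      have := Set.ncard_insert_of_notMem (K.notMem_neighborSet_self (a := v)) (Set.toFinite _)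
      rw [hins, Set.ncard_univ, hv, Nat.card_eq_fintype_card] at this
      exact this
    subst htop
    exact ⟨Iso.completeGraph (Fintype.equivFinOfCardEq hcard5)⟩
  · right
    push Not at h4
    have hreg : ∀ v, (K.neighborSet v).ncard = 3 := by
      intro v
      obtain ⟨a, b, hab, hv⟩ := KuratowskiLemma.exists_adj_avoiding hcard hedge hdeg v
      have := KuratowskiLemma.ncard_neighborSet_le_four hab.ne (h2 hab hv)
      have := h3 v
      have := h4 v
      omega
    obtain ⟨v, -, -⟩ := hedge
    have hsplit : ∀ a b, K.Adj a b → (a ∈ K.neighborSet v ↔ b ∉ K.neighborSet v) := by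
      intro a b hab
      simp only [mem_neighborSet]
      by_cases hav : a = v
      · subst hav; simpa using hab
      by_cases hbv : b = v
      · subst hbv; simpa using hab.symm
      have hv2 := h2 hab (v := v) ⟨Ne.symm hav, Ne.symm hbv⟩
      have hor := KuratowskiLemma.adj_or_adj_of_ncard_le_two (h3 v) hv2.le
      have hand := (KuratowskiLemma.ncard_neighborSet_eq_four_iff hab.ne hv2).not.1 (h4 v)
      tauto
    have hnbr : ∀ w ∉ K.neighborSet v, K.neighborSet w = K.neighborSet v := by
      intro w hw
      refine Set.eq_of_subset_of_ncard_le (fun z hz => ?_) (by rw [hreg, hreg]) (Set.toFinite _)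
      by_contra hzv
      exact hw ((hsplit w z hz).2 hzv)
    have hadj : ∀ a b, K.Adj a b ↔ (a ∈ K.neighborSet v ↔ b ∉ K.neighborSet v) := by
      refine fun a b => ⟨hsplit a b, fun hab => ?_⟩
      by_cases ha : a ∈ K.neighborSet v
      · rw [← hnbr b (hab.1 ha)] at ha
        exact K.adj_symm ha
      · have hb : b ∈ K.neighborSet v := by
          by_contra hb
          exact ha (hab.2 hb)
        rwa [← hnbr a ha] at hb
    obtain ⟨z, hz, -⟩ := hother v v
    have hcompl : (K.neighborSet v)ᶜ = K.neighborSet z := by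
      ext w
      have := hadj z w
      simp only [Set.mem_compl_iff, mem_neighborSet] at this ⊢
      tauto
    exact KuratowskiLemma.nonempty_iso_completeBipartiteGraph (hreg v) (by rw [hcompl, hreg]) hadj
end

section
/- Let K be a finite simple graph with at least three vertices and at least one edge. Suppose that for every edge xy of K, the graph K − x − y contains no θ-subgraph and every vertex of K − x − y has at least two neighbors in K − x − y. Then for every edge xy of K, the graph K − x − y is a cycle on n ≥ 3 vertices. -/
open SimpleGraph

namespace SimpleGraph

variable {V : Type*} {G : SimpleGraph V} {s : Set V}

/-- A cycle together with an ear (a path between two distinct vertices of the cycle, internally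
disjoint from it and not contained in it) is a θ-subgraph. -/
theorem hasThetaIn_of_cycle_of_ear {o a b : V} {c : G.Walk o o} {e : G.Walk a b}
    (hc : c.IsCycle) (he : e.IsPath) (hab : a ≠ b) (ha : a ∈ c.support) (hb : b ∈ c.support)
    (hcs : ∀ w ∈ c.support, w ∈ s) (hes : ∀ w ∈ e.support, w ∈ s)
    (hce : ∀ w ∈ c.support, w ∈ e.support → w = a ∨ w = b)
    (hne : ∃ f ∈ e.edges, f ∉ c.edges) : HasThetaIn G s := by
  classical
  obtain ⟨f, hfe, hfc⟩ := hne
  have hr : (c.rotate a ha).IsCycle := hc.rotate ha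
  have hrs : ∀ w, w ∈ (c.rotate a ha).support ↔ w ∈ c.support := fun w ↦
    c.mem_support_rotate_iff a ha
  have hre : ∀ f, f ∈ (c.rotate a ha).edges ↔ f ∈ c.edges := fun f ↦ (c.rotate_edges a ha).mem_iff
  generalize c.rotate a ha = r at hr hrs hre
  obtain ⟨p, q, rfl⟩ := Walk.mem_support_iff_exists_append.1 ((hrs b).2 hb)
  have hpn : ¬ p.Nil := Walk.not_nil_of_ne hab
  have hqn : ¬ q.Nil := Walk.not_nil_of_ne hab.symm
  have hp := hr.isPath_of_append_left hqn
  have hq := hr.isPath_of_append_right hpn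
  have hpc : ∀ w ∈ p.support, w ∈ c.support := fun w hw ↦
    (hrs w).1 (Walk.mem_support_append_iff .. |>.2 (.inl hw))
  have hqc : ∀ w ∈ q.support, w ∈ c.support := fun w hw ↦
    (hrs w).1 (Walk.mem_support_append_iff .. |>.2 (.inr hw))
  have hpq : ∀ w ∈ p.support, w ∈ q.support → w = a ∨ w = b := by
    intro w hwp hwq
    by_contra! h
    have hd := hr.support_nodup
    rw [Walk.tail_support_append] at hd
    exact List.disjoint_of_nodup_append hd
      (((Walk.mem_support_iff _).1 hwp).resolve_left h.1)
      (((Walk.mem_support_iff _).1 hwq).resolve_left h.2)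
  have hpe : ∀ f ∈ p.edges, f ∈ c.edges := fun f hf ↦
    (hre f).1 (by rw [Walk.edges_append]; exact List.mem_append_left _ hf)
  have hqe : ∀ f ∈ q.edges, f ∈ c.edges := fun f hf ↦
    (hre f).1 (by rw [Walk.edges_append]; exact List.mem_append_right _ hf)
  refine ⟨a, b, p, q.reverse, e, hcs a ha, hcs b hb, hab, hp, hq.reverse, he, ?_, ?_, ?_,
    fun w hw ↦ hcs w (hpc w hw), fun w hw ↦ hcs w (hqc w (by simpa using hw)), hes,
    fun w hw hw' ↦ hpq w hw (by simpa using hw'), fun w hw ↦ hce w (hpc w hw),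
    fun w hw ↦ hce w (hqc w (by simpa using hw))⟩
  · rintro rfl
    have hd := hr.edges_nodup
    rw [Walk.edges_append, Walk.edges_reverse] at hd
    obtain ⟨f, hf⟩ := List.exists_mem_of_ne_nil _ (mt Walk.edges_eq_nil.1 hqn)
    exact List.disjoint_of_nodup_append hd (List.mem_reverse.2 hf) hf
  · rintro rfl
    exact hfc (hpe f hfe)
  · rintro rfl
    exact hfc (hqe f (by simpa using hfe))

/-- A path inside `s` whose length is maximal among all paths inside `s`. -/
def IsLongestPathIn (s : Set V) {a b : V} (p : G.Walk a b) : Prop :=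
  p.IsPath ∧ (∀ w ∈ p.support, w ∈ s) ∧
    ∀ (u v : V) (q : G.Walk u v), q.IsPath → (∀ w ∈ q.support, w ∈ s) → q.length ≤ p.length

theorem exists_isLongestPathIn [Fintype V] (G : SimpleGraph V) (hs : s.Nonempty) :
    ∃ (a b : V) (p : G.Walk a b), IsLongestPathIn s p := by
  obtain ⟨z, hz⟩ := hs
  let L : Set ℕ := {n | ∃ (u v : V) (q : G.Walk u v), q.IsPath ∧ (∀ w ∈ q.support, w ∈ s) ∧
    q.length = n}
  have hne : L.Nonempty := ⟨0, z, z, .nil, .nil, by simpa using hz, rfl⟩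
  have hbdd : BddAbove L := by
    refine ⟨Fintype.card V, ?_⟩
    rintro _ ⟨u, v, q, hq, -, rfl⟩
    exact hq.length_lt.le
  obtain ⟨a, b, p, hp, hps, hl⟩ := Nat.sSup_mem hne hbdd
  refine ⟨a, b, p, hp, hps, fun u v q hq hqs ↦ ?_⟩
  rw [hl]
  exact le_csSup hbdd ⟨u, v, q, hq, hqs, rfl⟩

theorem IsLongestPathIn.mem_support_of_adj {a b w : V} {p : G.Walk a b}
    (h : IsLongestPathIn s p) (hw : w ∈ s) (haw : G.Adj a w) : w ∈ p.support := by
  by_contra hwp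
  have := h.2.2 _ _ (Walk.cons haw.symm p) (h.1.cons hwp) (by simpa [hw] using h.2.1)
  simp at this

/-- Closing up an initial segment of a path. -/
theorem isCycle_cons_of_append {a b u : V} {q : G.Walk a u} {d : G.Walk u b}
    (hp : (q.append d).IsPath) (hu : G.Adj u a) (hsnd : u ≠ (q.append d).snd) :
    (Walk.cons hu q).IsCycle := by
  refine (Walk.cons_isCycle_iff q hu).2 ⟨hp.of_append_left, fun hmem ↦ hsnd ?_⟩
  refine hp.eq_snd_of_mem_edges ?_
  rw [Walk.edges_append, Sym2.eq_swap]
  exact List.mem_append_left _ hmem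

/-- If the start of a path has two neighbors on it besides its successor,
there is a θ-subgraph. -/
theorem hasThetaIn_of_adj_of_adj {a b u w : V} {p : G.Walk a b} (hp : p.IsPath)
    (hps : ∀ w ∈ p.support, w ∈ s) (hau : G.Adj a u) (haw : G.Adj a w) (hu : u ∈ p.support)
    (hw : w ∈ p.support) (hup : u ≠ p.snd) (hwp : w ≠ p.snd) (huw : u ≠ w) : HasThetaIn G s := by
  have key : ∀ {u w : V} (q : G.Walk a u) (d : G.Walk u b), p = q.append d → G.Adj a u →
      G.Adj a w → u ≠ p.snd → w ≠ p.snd → u ≠ w → w ∈ q.support → HasThetaIn G s := by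
    rintro u w q d rfl hau haw hup hwp huw hw
    have hqs : ∀ w ∈ q.support, w ∈ s := fun w hw ↦
      hps w (Walk.mem_support_append_iff .. |>.2 (.inl hw))
    refine hasThetaIn_of_cycle_of_ear (e := haw.toWalk)
      (isCycle_cons_of_append hp hau.symm hup) (.of_adj haw) haw.ne
      (by simp) (by simp [hw]) ?_ ?_ ?_ ⟨s(a, w), by simp, ?_⟩
    · simpa [hqs u (by simp)] using hqs
    · simp [hqs w hw, hqs a (by simp)]
    · simp
    · simp only [Walk.edges_cons, List.mem_cons, not_or]
      refine ⟨by grind, fun h ↦ hwp (hp.eq_snd_of_mem_edges ?_)⟩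
      rw [Walk.edges_append]
      exact List.mem_append_left _ h
  obtain ⟨q, d, rfl⟩ := Walk.mem_support_iff_exists_append.1 hu
  rcases (Walk.mem_support_append_iff ..).1 hw with hwq | hwd
  · exact key q d rfl hau haw hup hwp huw hwq
  · obtain ⟨d₁, d₂, rfl⟩ := Walk.mem_support_iff_exists_append.1 hwd
    exact key (q.append d₁) d₂ (Walk.append_assoc ..) haw hau hwp hup huw.symm
      (Walk.mem_support_append_iff .. |>.2 (.inl (by simp)))

/-- In a set without θ-subgraphs and of minimum degree at least two, the start of a longest path
has exactly one neighbor besides its successor. -/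
theorem IsLongestPathIn.exists_neighbor [Finite V] (hθ : ¬ HasThetaIn G s)
    (hdeg : ∀ v ∈ s, 2 ≤ ({w ∈ s | G.Adj v w}).ncard) {a b : V} {p : G.Walk a b}
    (hp : IsLongestPathIn s p) :
    ∃ u ∈ p.support, G.Adj a u ∧ u ≠ p.snd ∧ ∀ w ∈ s, G.Adj a w → w = p.snd ∨ w = u := by
  obtain ⟨u, ⟨hus, hau⟩, hne⟩ :=
    Set.exists_ne_of_one_lt_ncard (hdeg a (hp.2.1 a (by simp))) p.snd
  have hu := hp.mem_support_of_adj hus hau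
  refine ⟨u, hu, hau, hne, fun w hw haw ↦ ?_⟩
  by_contra! h
  exact hθ (hasThetaIn_of_adj_of_adj hp.1 hp.2.1 hau haw hu (hp.mem_support_of_adj hw haw)
    hne h.1 h.2.symm)

/-- Splitting a path at a vertex that is neither its start nor the successor of the start. -/
theorem exists_append_cons {a b u : V} {p : G.Walk a b} (hp : p.IsPath) (hu : u ∈ p.support)
    (hau : a ≠ u) (hsnd : u ≠ p.snd) :
    ∃ (t : V) (q : G.Walk a t) (ht : G.Adj t u) (d : G.Walk u b),
      p = q.append (.cons ht d) ∧ a ≠ t := by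
  obtain ⟨q, d, rfl⟩ := Walk.mem_support_iff_exists_append.1 hu
  have hq := q.concat_dropLast (q.adj_penultimate (Walk.not_nil_of_ne hau))
  refine ⟨_, q.dropLast, q.adj_penultimate (Walk.not_nil_of_ne hau), d, ?_, fun h ↦ hsnd ?_⟩
  · rw [← Walk.concat_append, hq]
  · refine hp.eq_snd_of_mem_edges ?_
    rw [Walk.edges_append, ← hq, Walk.edges_concat]
    simp [← h]

/-- Reversing an initial segment along an edge from the start of a longest path. -/
theorem IsLongestPathIn.rotate_initial {a b t u : V} {q : G.Walk a t} {ht : G.Adj t u}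
    {d : G.Walk u b} (hp : IsLongestPathIn s (q.append (.cons ht d))) (hau : G.Adj a u) :
    IsLongestPathIn s (q.reverse.append (.cons hau d)) := by
  obtain ⟨hp, hps, hmax⟩ := hp
  refine ⟨?_, fun w hw ↦ hps w ?_, ?_⟩
  · rw [Walk.isPath_def] at hp ⊢
    simpa [Walk.support_append] using
      (((List.reverse_perm q.support).append_right d.support).nodup_iff).2
        (by simpa [Walk.support_append] using hp)
  · simpa [Walk.support_append] using hw
  · simpa using hmax

/-- Two vertices outside an edge `xy`, each adjacent to `x` or `y`, are joined by a path
through `x` or `y`. -/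
theorem exists_path_through_edge {x y a b : V} (hxy : G.Adj x y) (ha : a ∈ delTwo x y)
    (hb : b ∈ delTwo x y) (hab : a ≠ b) (hax : G.Adj a x ∨ G.Adj a y)
    (hbx : G.Adj b x ∨ G.Adj b y) :
    ∃ e : G.Walk a b, e.IsPath ∧ (∀ w ∈ e.support, w = a ∨ w = b ∨ w = x ∨ w = y) ∧
      ∃ f ∈ e.edges, x ∈ f ∨ y ∈ f := by
  obtain ⟨hax', hay'⟩ := ha
  obtain ⟨hbx', hby'⟩ := hb
  have hne := hxy.ne
  rcases hax with hax | hay <;> rcases hbx with hbx | hby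
  · exact ⟨.cons hax (.cons hbx.symm .nil), by simp; grind, by simp, s(a, x), by simp⟩
  · exact ⟨.cons hax (.cons hxy (.cons hby.symm .nil)), by simp; grind, by simp,
      s(a, x), by simp⟩
  · exact ⟨.cons hay (.cons hxy.symm (.cons hbx.symm .nil)), by simp; grind, by simp,
      s(a, y), by simp⟩
  · exact ⟨.cons hay (.cons hby.symm .nil), by simp; grind, by simp, s(a, y), by simp⟩

/-- The hypothesis on `K`: deleting the ends of any edge leaves a graph without θ-subgraphs
and of minimum degree at least two. -/
def EdgeDeletionsThetaFree (K : SimpleGraph V) : Prop :=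
  ∀ x y, K.Adj x y → ¬ HasThetaIn K (delTwo x y) ∧
    ∀ v ∈ delTwo x y, 2 ≤ ({w ∈ delTwo x y | K.Adj v w}).ncard

variable {K : SimpleGraph V} {x y : V}

/-- Once two vertices of a cycle of `K − x − y` are adjacent to `x` or `y`, every edge of
`K − x − y` meets the cycle. -/
theorem EdgeDeletionsThetaFree.edge_meets_cycle (h : EdgeDeletionsThetaFree K) (hxy : K.Adj x y)
    {o a b z w : V} {c : K.Walk o o} (hc : c.IsCycle) (hcs : ∀ w ∈ c.support, w ∈ delTwo x y)
    (ha : a ∈ c.support) (hb : b ∈ c.support) (hab : a ≠ b)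
    (hax : K.Adj a x ∨ K.Adj a y) (hbx : K.Adj b x ∨ K.Adj b y)
    (hz : z ∈ delTwo x y) (hw : w ∈ delTwo x y) (hzw : K.Adj z w) :
    z ∈ c.support ∨ w ∈ c.support := by
  by_contra! hzwc
  obtain ⟨e, he, hes, f, hfe, hf⟩ := exists_path_through_edge hxy (hcs a ha) (hcs b hb) hab hax hbx
  refine (h z w hzw).1 (hasThetaIn_of_cycle_of_ear hc he hab ha hb ?_ ?_ ?_ ⟨f, hfe, fun hfc ↦ ?_⟩)
  · exact fun v hv ↦ ⟨fun hvz ↦ hzwc.1 (hvz ▸ hv), fun hvw ↦ hzwc.2 (hvw ▸ hv)⟩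
  · intro v hv
    obtain ⟨hz₁, hz₂⟩ := hz
    obtain ⟨hw₁, hw₂⟩ := hw
    rcases hes v hv with rfl | rfl | rfl | rfl
    · exact ⟨fun hvz ↦ hzwc.1 (hvz ▸ ha), fun hvw ↦ hzwc.2 (hvw ▸ ha)⟩
    · exact ⟨fun hvz ↦ hzwc.1 (hvz ▸ hb), fun hvw ↦ hzwc.2 (hvw ▸ hb)⟩
    · exact ⟨hz₁.symm, hw₁.symm⟩
    · exact ⟨hz₂.symm, hw₂.symm⟩
  · intro v hv hve
    have := hcs v hv
    rcases hes v hve with rfl | rfl | rfl | rfl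
    · exact .inl rfl
    · exact .inr rfl
    · exact absurd rfl this.1
    · exact absurd rfl this.2
  · rcases hf with hf | hf
    · exact (hcs x (Walk.mem_support_of_mem_edges hfc hf)).1 rfl
    · exact (hcs y (Walk.mem_support_of_mem_edges hfc hf)).2 rfl

/-- The start of a longest path in `K − x − y` is adjacent to `x` or `y`. -/
theorem EdgeDeletionsThetaFree.adj_of_isLongestPathIn [Finite V] (h : EdgeDeletionsThetaFree K)
    (hxy : K.Adj x y) {a b : V} {p : K.Walk a b} (hp : IsLongestPathIn (delTwo x y) p) :
    K.Adj a x ∨ K.Adj a y := by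
  obtain ⟨u, hu, hau, hne, hnbr⟩ := hp.exists_neighbor (h x y hxy).1 (h x y hxy).2
  obtain ⟨t, q, ht, d, rfl, hat⟩ := exists_append_cons hp.1 hu hau.ne hne
  obtain ⟨w, ⟨hw, haw⟩, hwne⟩ := Set.exists_ne_of_one_lt_ncard
    ((h t u ht).2 a ⟨hat, hau.ne⟩) (q.append (.cons ht d)).snd
  by_cases hws : w ∈ delTwo x y
  · exact absurd (hnbr w hws haw) (not_or.2 ⟨hwne, hw.2⟩)
  · have : w = x ∨ w = y := by
      by_contra! h
      exact hws h
    rcases this with rfl | rfl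
    · exact .inl haw
    · exact .inr haw

/-- `K − x − y` has a cycle with two vertices adjacent to `x` or `y`. -/
theorem EdgeDeletionsThetaFree.exists_cycle [Fintype V] (h : EdgeDeletionsThetaFree K)
    (hxy : K.Adj x y) (hne : (delTwo x y).Nonempty) :
    ∃ (o a b : V) (c : K.Walk o o), c.IsCycle ∧ (∀ w ∈ c.support, w ∈ delTwo x y) ∧
      a ∈ c.support ∧ b ∈ c.support ∧ a ≠ b ∧
      (K.Adj a x ∨ K.Adj a y) ∧ (K.Adj b x ∨ K.Adj b y) := by
  obtain ⟨a, b, p, hp⟩ := exists_isLongestPathIn K hne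
  have hax := h.adj_of_isLongestPathIn hxy hp
  obtain ⟨u, hu, hau, hsnd, -⟩ := hp.exists_neighbor (h x y hxy).1 (h x y hxy).2
  obtain ⟨t, q, ht, d, rfl, hat⟩ := exists_append_cons hp.1 hu hau.ne hsnd
  have htx := h.adj_of_isLongestPathIn hxy (hp.rotate_initial hau)
  have hps := hp.2.1
  simp only [← Walk.concat_append] at hp hsnd
  refine ⟨u, a, t, _, isCycle_cons_of_append hp.1 hau.symm hsnd, fun w hw ↦ hps w ?_,
    by simp, by simp [Walk.support_concat], hat, hax, htx⟩
  rw [Walk.mem_support_append_iff]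
  simp [Walk.support_concat] at hw ⊢
  grind [Walk.start_mem_support]

/-- Every vertex of `K − x − y` lies on such a cycle. -/
theorem EdgeDeletionsThetaFree.mem_support_cycle [Finite V] (h : EdgeDeletionsThetaFree K)
    (hxy : K.Adj x y) {o a b : V} {c : K.Walk o o} (hc : c.IsCycle)
    (hcs : ∀ w ∈ c.support, w ∈ delTwo x y) (ha : a ∈ c.support) (hb : b ∈ c.support) (hab : a ≠ b)
    (hax : K.Adj a x ∨ K.Adj a y) (hbx : K.Adj b x ∨ K.Adj b y) {v : V} (hv : v ∈ delTwo x y) :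
    v ∈ c.support := by
  by_contra hvc
  obtain ⟨w, w', ⟨hw, hvw⟩, ⟨hw', hvw'⟩, hne⟩ :=
    (Set.one_lt_ncard_iff (Set.toFinite _)).1 ((h x y hxy).2 v hv)
  have hwc := (h.edge_meets_cycle hxy hc hcs ha hb hab hax hbx hv hw hvw).resolve_left hvc
  have hwc' := (h.edge_meets_cycle hxy hc hcs ha hb hab hax hbx hv hw' hvw').resolve_left hvc
  refine (h x y hxy).1 (hasThetaIn_of_cycle_of_ear (e := .cons hvw.symm (.cons hvw' .nil))
    hc ?_ hne hwc hwc' hcs ?_ ?_ ⟨s(w, v), by simp,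
      fun hf ↦ hvc (Walk.snd_mem_support_of_mem_edges c hf)⟩)
  · simpa [hvw'.ne, hne] using hvw.ne'
  · simp [hv, hw, hw']
  · grind [Walk.support_cons, Walk.support_nil]

end SimpleGraph

/-- **Lemma on the Kuratowski graphs, (1) ⇒ (2).** If `K` is a finite simple graph with
at least three vertices and at least one edge such that for every edge `xy` the graph
`K − x − y` contains no θ-subgraph and every vertex of `K − x − y` has at least two
neighbors in `K − x − y`, then for every edge `xy` of `K` the graph `K − x − y` is a
cycle on `n ≥ 3` vertices. -/
theorem stmt_1 {V : Type*} [Fintype V] (K : SimpleGraph V)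
    (hcard : 3 ≤ Fintype.card V)
    (hedge : ∃ x y, K.Adj x y)
    (h : ∀ x y, K.Adj x y →
      ¬ HasThetaIn K (delTwo x y) ∧
      ∀ v ∈ delTwo x y, 2 ≤ ({w ∈ delTwo x y | K.Adj v w}).ncard) :
    ∀ x y, K.Adj x y → ∃ n, IsCycleSetOn K (delTwo x y) n := by
  intro x y hxy
  have hθ : EdgeDeletionsThetaFree K := h
  have hne : (delTwo x y).Nonempty := by
    classical
    obtain ⟨z, hz⟩ := Finset.exists_mem_notMem_of_card_lt_card
      (s := {x, y}) (t := Finset.univ) (Finset.card_le_two.trans_lt hcard)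
    exact ⟨z, by simpa [delTwo] using hz⟩
  obtain ⟨o, a, b, c, hc, hcs, ha, hb, hab, hax, hbx⟩ := hθ.exists_cycle hxy hne
  have hmem : ∀ v, v ∈ delTwo x y ↔ v ∈ c.support := fun v ↦
    ⟨hθ.mem_support_cycle hxy hc hcs ha hb hab hax hbx, hcs v⟩
  have hdeg : ∀ v ∈ delTwo x y, ({w ∈ delTwo x y | K.Adj v w}).ncard = 2 := by
    intro v hv
    rw [← hc.ncard_neighborSet_toSubgraph_eq_two ((hmem v).1 hv)]
    congr 1
    ext w
    change _ ↔ c.toSubgraph.Adj v w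
    rw [Walk.adj_toSubgraph_iff_mem_edges]
    refine ⟨fun ⟨hw, hvw⟩ ↦ ?_, fun hvw ↦
      ⟨hcs w (c.snd_mem_support_of_mem_edges hvw), c.adj_of_mem_edges hvw⟩⟩
    by_contra hvwc
    exact (h x y hxy).1 (hasThetaIn_of_cycle_of_ear hc (.of_adj hvw) hvw.ne ((hmem v).1 hv)
      ((hmem w).1 hw) hcs (by simp [hv, hw]) (by simp) ⟨s(v, w), by simp, hvwc⟩)
  refine ⟨_, ?_, rfl, ?_, hdeg⟩
  · obtain ⟨v, hv⟩ := hne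
    have hvn : v ∉ {w ∈ delTwo x y | K.Adj v w} := fun hv ↦ hv.2.ne rfl
    have hins := Set.ncard_insert_of_notMem hvn
    rw [hdeg v hv] at hins
    exact hins.symm.le.trans <| Set.ncard_le_ncard (Set.insert_subset hv fun w hw ↦ hw.1)
  · rw [show delTwo x y = {v | v ∈ c.support} from Set.ext hmem]
    exact c.connected_induce_support
end

section
/- Let K be a finite simple graph with at least one edge such that for every edge xy of K, the graph K − x − y is a cycle on n ≥ 3 vertices. Then K is isomorphic to the complete graph K_5 or to the complete bipartite graph K_{3,3}. -/
open SimpleGraph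

/-- Removing an adjacent pair `x, y` leaves every other vertex with exactly two neighbors. -/
def LeavesTwo {V : Type*} (K : SimpleGraph V) : Prop :=
  ∀ x y v, K.Adj x y → v ≠ x → v ≠ y → {w ∈ delTwo x y | K.Adj v w}.ncard = 2

section

variable {V : Type*} {K : SimpleGraph V}

theorem LeavesTwo.exists_adj_ne (hK : LeavesTwo K) {x y a : V} (hxy : K.Adj x y)
    (hax : a ≠ x) (hay : a ≠ y) (v : V) : ∃ p q, K.Adj p q ∧ v ≠ p ∧ v ≠ q := by
  obtain ⟨b, hb, hab⟩ : {w ∈ delTwo x y | K.Adj a w}.Nonempty :=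
    Set.nonempty_of_ncard_ne_zero (by rw [hK x y a hxy hax hay]; decide)
  obtain ⟨hbx, hby⟩ := hb
  by_cases hv : v = x ∨ v = y
  · refine ⟨a, b, hab, ?_⟩
    grind
  · exact ⟨x, y, hxy, by tauto, by tauto⟩

variable [Fintype V] [DecidableEq V] [DecidableRel K.Adj]

theorem LeavesTwo.degree_eq (hK : LeavesTwo K) {x y v : V} (hxy : K.Adj x y)
    (hx : v ≠ x) (hy : v ≠ y) :
    K.degree v = 2 + (if K.Adj v x then 1 else 0) + (if K.Adj v y then 1 else 0) := by
  have h2 := hK x y v hxy hx hy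
  have hset : {w ∈ delTwo x y | K.Adj v w} = ↑(K.neighborFinset v \ {x, y}) := by
    ext w
    simp [delTwo, and_comm]
  rw [hset, Set.ncard_coe_finset] at h2
  have hcap := Finset.card_sdiff_add_card_inter (K.neighborFinset v) {x, y}
  rw [h2, K.card_neighborFinset_eq_degree] at hcap
  rw [← hcap, add_assoc, Finset.inter_comm]
  have hne : x ≠ y := hxy.ne
  by_cases h1 : K.Adj v x <;> by_cases h3 : K.Adj v y <;>
    simp [h1, h3, hne, Finset.insert_inter_of_mem, Finset.insert_inter_of_notMem]

theorem LeavesTwo.three_le_degree (hK : LeavesTwo K)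
    (hfar : ∀ v, ∃ p q, K.Adj p q ∧ v ≠ p ∧ v ≠ q) (v : V) : 3 ≤ K.degree v := by
  have two_le : ∀ u, 2 ≤ K.degree u := fun u ↦ by
    obtain ⟨p, q, hpq, hp, hq⟩ := hfar u
    rw [hK.degree_eq hpq hp hq]
    omega
  obtain ⟨u, hu⟩ : ∃ u, K.Adj v u :=
    (K.degree_pos_iff_exists_adj v).1 (by have := two_le v; omega)
  obtain ⟨w, hw, hwv⟩ := Finset.exists_mem_ne
    (show 1 < (K.neighborFinset u).card from two_le u) v
  rw [mem_neighborFinset] at hw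
  rw [hK.degree_eq hw hu.ne hwv.symm, if_pos hu]
  omega

theorem LeavesTwo.degree_eq_three_or_four (hK : LeavesTwo K)
    (hfar : ∀ v, ∃ p q, K.Adj p q ∧ v ≠ p ∧ v ≠ q) (v : V) :
    K.degree v = 3 ∨ K.degree v = 4 := by
  obtain ⟨p, q, hpq, hp, hq⟩ := hfar v
  have h3 := hK.three_le_degree hfar v
  have := hK.degree_eq hpq hp hq
  split_ifs at this <;> omega

theorem LeavesTwo.adj_of_degree_eq_four (hK : LeavesTwo K)
    (hfar : ∀ v, ∃ p q, K.Adj p q ∧ v ≠ p ∧ v ≠ q) {v w : V} (hv : K.degree v = 4)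
    (hvw : v ≠ w) : K.Adj v w := by
  by_contra hnot
  obtain ⟨u, hu⟩ : ∃ u, K.Adj w u := (K.degree_pos_iff_exists_adj w).1
    (by have := hK.three_le_degree hfar w; omega)
  have hvu : v ≠ u := by
    rintro rfl
    exact hnot hu.symm
  have := hK.degree_eq hu hvw hvu
  rw [if_neg hnot] at this
  split_ifs at this <;> omega

theorem LeavesTwo.xor_adj_of_degree_eq_three (hK : LeavesTwo K) {v x y : V}
    (hv : K.degree v = 3) (hxy : K.Adj x y) (hx : v ≠ x) (hy : v ≠ y) :
    K.Adj v x ↔ ¬ K.Adj v y := by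
  have := hK.degree_eq hxy hx hy
  split_ifs at this <;> first | omega | tauto

theorem LeavesTwo.eq_top_of_degree_eq_four (hK : LeavesTwo K)
    (hfar : ∀ v, ∃ p q, K.Adj p q ∧ v ≠ p ∧ v ≠ q) {v : V} (hv : K.degree v = 4) :
    K = ⊤ := by
  refine eq_top_iff.2 fun w u hwu ↦ ?_
  rw [top_adj] at hwu
  refine hK.adj_of_degree_eq_four hfar ?_ hwu
  refine (hK.degree_eq_three_or_four hfar w).resolve_left fun hw ↦ ?_
  have hwv : w ≠ v := by
    rintro rfl
    omega
  have hadj : K.Adj w v := (hK.adj_of_degree_eq_four hfar hv hwv.symm).symm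
  obtain ⟨z, hz, hzv⟩ := Finset.exists_mem_ne
    (show 1 < (K.neighborFinset w).card by rw [K.card_neighborFinset_eq_degree]; omega) v
  rw [mem_neighborFinset] at hz
  exact (hK.xor_adj_of_degree_eq_three hw (hK.adj_of_degree_eq_four hfar hv hzv.symm)
    hadj.ne hz.ne).1 hadj hz

theorem LeavesTwo.adj_iff_of_forall_degree_eq_three (hK : LeavesTwo K)
    (hdeg : ∀ v, K.degree v = 3) (v x y : V) :
    K.Adj x y ↔ (K.Adj v x ↔ ¬ K.Adj v y) := by
  have side : ∀ {x y}, K.Adj x y → (K.Adj v x ↔ ¬ K.Adj v y) := fun {x y} hxy ↦ by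
    by_cases hx : v = x
    · subst hx
      simp [hxy]
    by_cases hy : v = y
    · subst hy
      simp [hxy.symm]
    exact hK.xor_adj_of_degree_eq_three (hdeg v) hxy hx hy
  have complete : ∀ {w z}, ¬ K.Adj v w → K.Adj v z → K.Adj w z := fun {w z} hw hz ↦ by
    have hsub : K.neighborFinset w ⊆ K.neighborFinset v := fun u hu ↦ by
      rw [mem_neighborFinset] at hu ⊢
      exact not_not.1 (mt (side hu).2 hw)
    have heq := Finset.eq_of_subset_of_card_le hsub (by simp [hdeg])
    rwa [← mem_neighborFinset, heq, mem_neighborFinset]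
  refine ⟨side, fun hiff ↦ ?_⟩
  by_cases hx : K.Adj v x
  · exact (complete (hiff.1 hx) hx).symm
  · exact complete hx (not_not.1 (mt hiff.2 hx))

theorem LeavesTwo.nonempty_iso_completeBipartiteGraph (hK : LeavesTwo K)
    (hdeg : ∀ v, K.degree v = 3) (v : V) :
    Nonempty (K ≃g completeBipartiteGraph (Fin 3) (Fin 3)) := by
  have hadj := hK.adj_iff_of_forall_degree_eq_three hdeg v
  obtain ⟨u, hu⟩ : ∃ u, K.Adj v u :=
    (K.degree_pos_iff_exists_adj v).1 (by rw [hdeg]; decide)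
  have hleft : Fintype.card {w // K.Adj v w} = 3 := by
    rw [← hdeg v, Fintype.card_subtype, ← K.card_neighborFinset_eq_degree,
      K.neighborFinset_eq_filter]
  have hright : Fintype.card {w // ¬ K.Adj v w} = 3 := by
    rw [← hdeg u, Fintype.card_subtype, ← K.card_neighborFinset_eq_degree,
      K.neighborFinset_eq_filter]
    congr 1
    ext w
    simp [hadj u w, hu]
  let f : {w // K.Adj v w} ⊕ {w // ¬ K.Adj v w} ≃ Fin 3 ⊕ Fin 3 :=
    Equiv.sumCongr (Fintype.equivFinOfCardEq hleft) (Fintype.equivFinOfCardEq hright)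
  let e := Equiv.sumCompl fun w ↦ K.Adj v w
  refine ⟨RelIso.symm ⟨f.symm.trans e, fun {a b} ↦ ?_⟩⟩
  obtain ⟨a, rfl⟩ := f.surjective a
  obtain ⟨b, rfl⟩ := f.surjective b
  rw [hadj]
  rcases a with ⟨a, ha⟩ | ⟨a, ha⟩ <;> rcases b with ⟨b, hb⟩ | ⟨b, hb⟩ <;>
    simp [f, e, ha, hb]

end

/-- **Lemma on the Kuratowski graphs, (2) ⇒ (3).** If `K` is a finite simple graph with
at least one edge such that for every edge `xy` the graph `K − x − y` is a cycle on
`n ≥ 3` vertices, then `K` is isomorphic to `K₅` or to `K₃,₃`. -/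
theorem stmt_2 {V : Type*} [Fintype V] (K : SimpleGraph V)
    (hedge : ∃ x y, K.Adj x y)
    (h : ∀ x y, K.Adj x y → ∃ n, IsCycleSetOn K (delTwo x y) n) :
    Nonempty (K ≃g (⊤ : SimpleGraph (Fin 5))) ∨
    Nonempty (K ≃g completeBipartiteGraph (Fin 3) (Fin 3)) := by
  classical
  have hK : LeavesTwo K := fun x y v hxy hx hy ↦ by
    obtain ⟨n, -, -, -, htwo⟩ := h x y hxy
    exact htwo v ⟨hx, hy⟩
  obtain ⟨x, y, hxy⟩ := hedge
  obtain ⟨n, hn, hcard, -, -⟩ := h x y hxy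
  obtain ⟨a, hax, hay⟩ : (delTwo x y).Nonempty :=
    Set.nonempty_of_ncard_ne_zero (by omega)
  have hfar := hK.exists_adj_ne hxy hax hay
  by_cases hfour : ∃ v, K.degree v = 4
  · obtain ⟨v, hv⟩ := hfour
    obtain rfl := hK.eq_top_of_degree_eq_four hfar hv
    have hV : Fintype.card V = 5 := by
      have : 0 < Fintype.card V := Fintype.card_pos_iff.2 ⟨v⟩
      have htop : Fintype.card V - 1 = 4 := by
        rw [← hv]
        simp [← SimpleGraph.card_neighborFinset_eq_degree,
          SimpleGraph.neighborFinset_eq_filter, Finset.filter_ne, Finset.card_erase_of_mem]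
      omega
    exact .inl ⟨Iso.completeGraph (Fintype.equivFinOfCardEq hV)⟩
  · exact .inr (hK.nonempty_iso_completeBipartiteGraph
      (fun w ↦ (hK.degree_eq_three_or_four hfar w).resolve_right fun hw ↦ hfour ⟨w, hw⟩) x)
end

section
/- Let K be a finite simple graph such that for every edge xy of K, the graph K − x − y is a cycle on n ≥ 3 vertices, and suppose that for some edge xy of K the graph K − x − y is a cycle on 3 vertices. Then K is isomorphic to the complete graph K_5. -/
open SimpleGraph

theorem ncard_delTwo_add_two {V : Type*} [Fintype V] {x y : V} (hxy : x ≠ y) :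
    (delTwo x y).ncard + 2 = Fintype.card V := by
  have hcompl : delTwo x y = ({x, y} : Set V)ᶜ := by
    ext v
    simp [delTwo]
  rw [hcompl, ← Set.ncard_pair hxy, add_comm, Set.ncard_add_ncard_compl,
    Nat.card_eq_fintype_card]

/-- A cycle on three vertices is a triangle. -/
theorem IsCycleSetOn.adj_of_three {V : Type*} [Finite V] {G : SimpleGraph V} {s : Set V}
    (hs : IsCycleSetOn G s 3) {p q : V} (hp : p ∈ s) (hq : q ∈ s) (hpq : p ≠ q) :
    G.Adj p q := by
  obtain ⟨-, hcard, -, hdeg⟩ := hs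
  have hsub : {w ∈ s | G.Adj p w} ⊆ s \ {p} := fun w hw => ⟨hw.1, hw.2.ne'⟩
  have hle : (s \ {p}).ncard ≤ {w ∈ s | G.Adj p w}.ncard := by
    rw [hdeg p hp, Set.ncard_sdiff_singleton_of_mem hp, hcard]
  have heq := Set.eq_of_subset_of_ncard_le hsub hle
  have hmem : q ∈ s \ {p} := ⟨hq, hpq.symm⟩
  rw [← heq] at hmem
  exact hmem.2

/-- If `K` is a finite simple graph such that for every edge `xy` the graph `K − x − y`
is a cycle on `n ≥ 3` vertices, and for some edge `xy` the graph `K − x − y` is a cycle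
on `3` vertices, then `K` is isomorphic to `K₅`. -/
theorem stmt_8 {V : Type*} [Fintype V] (K : SimpleGraph V)
    (h : ∀ x y, K.Adj x y → ∃ n, IsCycleSetOn K (delTwo x y) n)
    (h3 : ∃ x y, K.Adj x y ∧ IsCycleSetOn K (delTwo x y) 3) :
    Nonempty (K ≃g (⊤ : SimpleGraph (Fin 5))) := by
  obtain ⟨x, y, hxy, hcyc⟩ := h3
  have hV : Fintype.card V = 5 := by
    rw [← ncard_delTwo_add_two hxy.ne, hcyc.2.1]
  have hadj : ∀ u v p q, K.Adj u v → p ∈ delTwo u v → q ∈ delTwo u v → p ≠ q → K.Adj p q := by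
    intro u v p q huv hp hq hpq
    obtain ⟨n, hn⟩ := h u v huv
    have hcard := ncard_delTwo_add_two huv.ne
    have hn3 : n = 3 := by
      have := hn.2.1
      omega
    subst hn3
    exact hn.adj_of_three hp hq hpq
  have hmixed : ∀ u v q, K.Adj u v → q ∈ delTwo u v → K.Adj u q := by
    intro u v q huv hq
    have hcard := ncard_delTwo_add_two huv.ne
    have hone : 1 < (delTwo u v \ {q}).ncard := by
      rw [Set.ncard_sdiff_singleton_of_mem hq]
      omega
    obtain ⟨a, b, ha, hb, hab⟩ := (Set.one_lt_ncard_iff).1 hone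
    exact hadj a b u q (hadj u v a b huv ha.1 hb.1 hab) ⟨ha.1.1.symm, hb.1.1.symm⟩
      ⟨Ne.symm ha.2, Ne.symm hb.2⟩ hq.1.symm
  have htop : K = ⊤ := by
    refine eq_top_iff.2 fun p q hpq => ?_
    rw [top_adj] at hpq
    have hjoin : ∀ u v, K.Adj u v → ∀ w, u ≠ w → K.Adj u w := by
      intro u v huv w hw
      obtain rfl | hwv := eq_or_ne w v
      · exact huv
      · exact hmixed u v w huv ⟨hw.symm, hwv⟩
    obtain rfl | hpx := eq_or_ne x p
    · exact hjoin x y hxy q hpq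
    · exact hjoin p x (hjoin x y hxy p hpx).symm q hpq
  subst htop
  exact ⟨Iso.completeGraph (Fintype.equivFinOfCardEq hV)⟩
end

section
/- Let K be a finite simple graph such that for every edge xy of K, the graph K − x − y is a cycle on n ≥ 3 vertices, and suppose that for some edge xy of K the graph K − x − y is a cycle on 4 vertices. Then K is isomorphic to the complete bipartite graph K_{3,3}. -/
open SimpleGraph

/-- If a two-element set lies in `{p, q, r}` and contains `p`, then it contains exactly one
of `q` and `r`. -/
lemma mem_iff_notMem_of_ncard_eq_two {α : Type*} {T : Set α} {p q r : α} (hT : T.ncard = 2)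
    (hp : p ∈ T) (hsub : ∀ w ∈ T, w = p ∨ w = q ∨ w = r) (hpq : p ≠ q) (hpr : p ≠ r)
    (hqr : q ≠ r) : q ∈ T ↔ r ∉ T := by
  obtain ⟨u, v, huv, rfl⟩ := Set.ncard_eq_two.1 hT
  have hu := hsub u (by simp)
  have hv := hsub v (by simp)
  simp only [Set.mem_insert_iff, Set.mem_singleton_iff] at *
  grind

/-- If deleting the ends of the edge `uv` leaves a cycle on the vertices `p, q, r, w`, and `w` is
adjacent to `p`, then `w` is adjacent to exactly one of `q` and `r`. -/
lemma adj_iff_not_adj_of_delTwo {V : Type*} {K : SimpleGraph V}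
    (h : ∀ x y, K.Adj x y → ∃ n, IsCycleSetOn K (delTwo x y) n) {u v w p q r : V}
    (hnd : [u, v, w, p, q, r].Nodup)
    (hall : ∀ z, z = u ∨ z = v ∨ z = w ∨ z = p ∨ z = q ∨ z = r)
    (huv : K.Adj u v) (hwp : K.Adj w p) : K.Adj w q ↔ ¬ K.Adj w r := by
  obtain ⟨n, -, -, -, hdeg⟩ := h u v huv
  simp only [List.nodup_cons, List.mem_cons, List.not_mem_nil, or_false, not_or] at hnd
  obtain ⟨⟨huv', huw, hup, huq, hur⟩, ⟨hvw, hvp, hvq, hvr⟩, ⟨hwp', hwq, hwr⟩, ⟨hpq, hpr⟩,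
    hqr, -⟩ := hnd
  have key := mem_iff_notMem_of_ncard_eq_two (q := q) (r := r)
    (hdeg w ⟨Ne.symm huw, Ne.symm hvw⟩) (p := p)
    ⟨⟨Ne.symm hup, Ne.symm hvp⟩, hwp⟩ ?_ hpq hpr hqr
  · simpa [delTwo, Ne.symm huq, Ne.symm hvq, Ne.symm hur, Ne.symm hvr] using key
  · rintro z ⟨⟨hzu, hzv⟩, hwz⟩
    rcases hall z with rfl | rfl | rfl | hz
    · exact absurd rfl hzu
    · exact absurd rfl hzv
    · exact absurd hwz K.irrefl
    · exact hz

/-- A cycle on four vertices is a set `{a, b, c, d}` whose adjacencies are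
`ab`, `bc`, `cd`, `da`. -/
lemma IsCycleSetOn.exists_of_four {V : Type*} {K : SimpleGraph V} {s : Set V}
    (hs : IsCycleSetOn K s 4) :
    ∃ a b c d, [a, b, c, d].Nodup ∧ s = {a, b, c, d} ∧ K.Adj a b ∧ K.Adj b c ∧ K.Adj c d ∧
      K.Adj d a ∧ ¬ K.Adj a c ∧ ¬ K.Adj b d := by
  obtain ⟨-, hcard, -, hdeg⟩ := hs
  have hfin : s.Finite := Set.finite_of_ncard_ne_zero (by omega)
  obtain ⟨a, ha⟩ : s.Nonempty := Set.nonempty_of_ncard_ne_zero (by omega)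
  obtain ⟨b, d, hbd, hN⟩ := Set.ncard_eq_two.1 (hdeg a ha)
  have hNa : ∀ w, (w ∈ s ∧ K.Adj a w) ↔ w = b ∨ w = d := fun w => by
    simpa using Set.ext_iff.1 hN w
  obtain ⟨hb, hab⟩ := (hNa b).2 (.inl rfl)
  obtain ⟨hd, had⟩ := (hNa d).2 (.inr rfl)
  have habd : ({a, b, d} : Set V).ncard = 3 :=
    Set.ncard_eq_three.2 ⟨a, b, d, hab.ne, had.ne, hbd, rfl⟩
  have hsub : ({a, b, d} : Set V) ⊆ s := by
    rintro w (rfl | rfl | rfl) <;> assumption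
  have hdiff : (s \ {a, b, d}).ncard = 1 := by
    rw [Set.ncard_sdiff hsub (by simp), hcard, habd]
  obtain ⟨c, hc⟩ := Set.ncard_eq_one.1 hdiff
  have hcs : ∀ w, (w ∈ s ∧ ¬ (w = a ∨ w = b ∨ w = d)) ↔ w = c := fun w => by
    simpa using Set.ext_iff.1 hc w
  obtain ⟨hcS, hcn⟩ := (hcs c).2 rfl
  obtain ⟨u, v, huv, hNc⟩ := Set.ncard_eq_two.1 (hdeg c hcS)
  obtain ⟨u', v', huv', hNb⟩ := Set.ncard_eq_two.1 (hdeg b hb)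
  have hNc' : ∀ w, (w ∈ s ∧ K.Adj c w) ↔ w = u ∨ w = v := fun w => by
    simpa using Set.ext_iff.1 hNc w
  have hNb' : ∀ w, (w ∈ s ∧ K.Adj b w) ↔ w = u' ∨ w = v' := fun w => by
    simpa using Set.ext_iff.1 hNb w
  have hac : ¬ K.Adj a c := fun hac => by
    have := (hNa c).1 ⟨hcS, hac⟩
    tauto
  have huc : u = b ∨ u = d := by
    have hu := (hNc' u).2 (.inl rfl)
    have := hu.2.ne
    grind [K.adj_comm]
  have hvc : v = b ∨ v = d := by
    have hv := (hNc' v).2 (.inr rfl)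
    have := hv.2.ne
    grind [K.adj_comm]
  have hcb : K.Adj c b := ((hNc' b).2 (by grind)).2
  have hcd : K.Adj c d := ((hNc' d).2 (by grind)).2
  have hnbd : ¬ K.Adj b d := fun hadj => by
    have h1 := (hNb' a).1 ⟨ha, hab.symm⟩
    have h2 := (hNb' c).1 ⟨hcS, hcb.symm⟩
    have h3 := (hNb' d).1 ⟨hd, hadj⟩
    have := had.ne
    grind
  refine ⟨a, b, c, d, ?_, ?_, hab, hcb.symm, hcd, had.symm, hac, hnbd⟩
  · have := hab.ne
    have := had.ne
    simp only [List.nodup_cons, List.mem_cons, List.not_mem_nil, or_false, not_or]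
    grind
  · ext w
    simp only [Set.mem_insert_iff, Set.mem_singleton_iff]
    grind

/-- A graph whose vertices split into two independent triples with all edges between them is
`K₃,₃`. -/
lemma nonempty_iso_completeBipartiteGraph_three {V : Type*} {K : SimpleGraph V}
    {f g : Fin 3 → V} (hf : f.Injective) (hg : g.Injective)
    (hall : ∀ z, z ∈ Set.range f ∨ z ∈ Set.range g) (hff : ∀ i j, ¬ K.Adj (f i) (f j))
    (hgg : ∀ i j, ¬ K.Adj (g i) (g j)) (hfg : ∀ i j, K.Adj (f i) (g j)) :
    Nonempty (K ≃g completeBipartiteGraph (Fin 3) (Fin 3)) := by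
  have hbij : Function.Bijective (Sum.elim f g) :=
    ⟨hf.sumElim hg fun i j => (hfg i j).ne, fun z => by simpa using hall z⟩
  refine ⟨(RelIso.mk (Equiv.ofBijective _ hbij) ?_ :
    completeBipartiteGraph (Fin 3) (Fin 3) ≃g K).symm⟩
  rintro (i | i) (j | j) <;> simp [hff, hgg, hfg, K.adj_comm (g _) (f _)]

/-- If the edge `xy` and the 4-cycle `abcd` make up `K`, with `x` joined to `a, c` and `y` to
`b, d` and no further edges, then `K` is `K₃,₃`. -/
lemma nonempty_iso_of_edge_of_four_cycle {V : Type*} {K : SimpleGraph V} {x y a b c d : V}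
    (hnd : [x, y, a, b, c, d].Nodup)
    (hall : ∀ z, z = x ∨ z = y ∨ z = a ∨ z = b ∨ z = c ∨ z = d)
    (hxy : K.Adj x y) (hab : K.Adj a b) (hbc : K.Adj b c) (hcd : K.Adj c d) (hda : K.Adj d a)
    (hac : ¬ K.Adj a c) (hbd : ¬ K.Adj b d) (hxa : K.Adj x a) (hxc : K.Adj x c)
    (hxb : ¬ K.Adj x b) (hxd : ¬ K.Adj x d) (hyb : K.Adj y b) (hyd : K.Adj y d)
    (hya : ¬ K.Adj y a) (hyc : ¬ K.Adj y c) :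
    Nonempty (K ≃g completeBipartiteGraph (Fin 3) (Fin 3)) := by
  simp only [List.nodup_cons, List.mem_cons, List.not_mem_nil, or_false, not_or] at hnd
  apply nonempty_iso_completeBipartiteGraph_three (f := ![x, b, d]) (g := ![y, a, c])
  · intro i j
    fin_cases i <;> fin_cases j <;> simp <;> grind
  · intro i j
    fin_cases i <;> fin_cases j <;> simp <;> grind
  · intro z
    have := hall z
    simp
    grind
  all_goals
    intro i j
    fin_cases i <;> fin_cases j <;> simp <;> first | assumption | (rw [K.adj_comm]; assumption)

/-- If the edge `uv` and the path `abcd` cover the vertices of `K`, then the adjacencies of `u`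
alternate along the cyclic order `a, b, c, d`. -/
lemma adj_alternates_on_four_path {V : Type*} {K : SimpleGraph V}
    (h : ∀ x y, K.Adj x y → ∃ n, IsCycleSetOn K (delTwo x y) n) {u v a b c d : V}
    (hab : K.Adj a b) (hbc : K.Adj b c) (hcd : K.Adj c d) (hnd : [u, v, a, b, c, d].Nodup)
    (hall : ∀ z, z = u ∨ z = v ∨ z = a ∨ z = b ∨ z = c ∨ z = d) (huv : K.Adj u v) :
    (K.Adj u c ↔ ¬ K.Adj u d) ∧ (K.Adj u d ↔ ¬ K.Adj u a) ∧ (K.Adj u a ↔ ¬ K.Adj u b) := by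
  refine ⟨adj_iff_not_adj_of_delTwo h ?_ (fun z => ?_) hab huv,
    adj_iff_not_adj_of_delTwo h ?_ (fun z => ?_) hbc huv,
    adj_iff_not_adj_of_delTwo h ?_ (fun z => ?_) hcd huv⟩
  case refine_2 | refine_4 | refine_6 =>
    simpa only [or_comm, or_left_comm] using hall z
  all_goals grind

/-- If `K` is a finite simple graph such that for every edge `xy` the graph `K − x − y`
is a cycle on `n ≥ 3` vertices, and for some edge `xy` the graph `K − x − y` is a cycle
on `4` vertices, then `K` is isomorphic to `K₃,₃`. -/
theorem stmt_9 {V : Type*} [Fintype V] (K : SimpleGraph V)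
    (h : ∀ x y, K.Adj x y → ∃ n, IsCycleSetOn K (delTwo x y) n)
    (h4 : ∃ x y, K.Adj x y ∧ IsCycleSetOn K (delTwo x y) 4) :
    Nonempty (K ≃g completeBipartiteGraph (Fin 3) (Fin 3)) := by
  obtain ⟨x, y, hxy, hcyc⟩ := h4
  obtain ⟨a, b, c, d, hnd', hs, hab, hbc, hcd, hda, hac, hbd⟩ := hcyc.exists_of_four
  have hmem : ∀ z, (z ≠ x ∧ z ≠ y) ↔ z = a ∨ z = b ∨ z = c ∨ z = d := fun z => by
    simpa [delTwo] using Set.ext_iff.1 hs z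
  have hall : ∀ z, z = x ∨ z = y ∨ z = a ∨ z = b ∨ z = c ∨ z = d := fun z => by
    have := hmem z
    tauto
  have hnd : [x, y, a, b, c, d].Nodup := by
    have := hxy.ne
    have := hmem x
    have := hmem y
    simp only [List.nodup_cons, List.mem_cons, List.not_mem_nil, or_false, not_or] at hnd' ⊢
    tauto
  obtain ⟨hx₁, hx₂, hx₃⟩ := adj_alternates_on_four_path h hab hbc hcd hnd hall hxy
  have hnd_swap : [y, x, a, b, c, d].Nodup := by grind
  have hall_swap : ∀ z, z = y ∨ z = x ∨ z = a ∨ z = b ∨ z = c ∨ z = d := fun z => by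
    simpa only [or_comm, or_left_comm] using hall z
  obtain ⟨hy₁, hy₂, hy₃⟩ :=
    adj_alternates_on_four_path h hab hbc hcd hnd_swap hall_swap hxy.symm
  by_cases hxa : K.Adj x a
  · have hb : K.Adj b y ↔ ¬ K.Adj b d :=
      adj_iff_not_adj_of_delTwo h (by grind)
        (fun z => by simpa only [or_comm, or_left_comm] using hall z) hxa hbc
    rw [K.adj_comm] at hb
    have hyb : K.Adj y b := hb.2 hbd
    have hxd : ¬ K.Adj x d := fun e => hx₂.1 e hxa
    have hya : ¬ K.Adj y a := fun e => hy₃.1 e hyb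
    have hyd : K.Adj y d := hy₂.2 hya
    exact nonempty_iso_of_edge_of_four_cycle hnd hall hxy hab hbc hcd hda hac hbd
      hxa (hx₁.2 hxd) (hx₃.1 hxa) hxd hyb hyd hya (fun e => hy₁.1 e hyd)
  · have hxb : K.Adj x b := not_not.1 (mt hx₃.2 hxa)
    have ha : K.Adj a y ↔ ¬ K.Adj a c :=
      adj_iff_not_adj_of_delTwo h (by grind)
        (fun z => by simpa only [or_comm, or_left_comm] using hall z) hxb hda.symm
    rw [K.adj_comm] at ha
    have hya : K.Adj y a := ha.2 hac
    have hyd : ¬ K.Adj y d := fun e => hy₂.1 e hya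
    have hxd : K.Adj x d := hx₂.2 hxa
    exact nonempty_iso_of_edge_of_four_cycle hnd_swap hall_swap hxy.symm hab hbc hcd hda hac hbd
      hya (hy₁.2 hyd) (hy₃.1 hya) hyd hxb hxd hxa (fun e => hx₁.1 e hxd)
end
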